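/- Let x : D → ℝ⁴ be a smooth minimal time-like surface in isothermal coordinates with E < 0, let y : D → ℝ⁴ satisfy y_u = x_v and y_v = x_u (the conjugate surface), and define ŷ on D̂ := {(u,v) : (v,u) ∈ D} by ŷ(u,v) := y(v,u). Then ŷ is a smooth minimal time-like surface in isothermal coordinates with Ê(u,v) = E(v,u) < 0; its normal projections satisfy â(u,v) = b(v,u) and b̂(u,v) = a(v,u), so that if x is in canonical coordinates with parameters (ε₀,ε₁) then so is ŷ with the same parameters (and the same type); and its curvatures satisfy K̂(u,v) = −K(v,u) and ϰ̂(u,v) = −ϰ(v,u). -/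

import Mathlib

noncomputable section

abbrev V4 : Type := Fin 4 → ℝ

/-- The indefinite scalar product of `ℝ⁴₂`. -/
def ip (a b : V4) : ℝ := -(a 0 * b 0) + a 1 * b 1 - a 2 * b 2 + a 3 * b 3

/-- Partial derivative w.r.t. the first variable. -/
def pu {E : Type*} [NormedAddCommGroup E] [NormedSpace ℝ E]
    (f : ℝ × ℝ → E) (p : ℝ × ℝ) : E := fderiv ℝ f p (1, 0)

/-- Partial derivative w.r.t. the second variable. -/
def pv {E : Type*} [NormedAddCommGroup E] [NormedSpace ℝ E]
    (f : ℝ × ℝ → E) (p : ℝ × ℝ) : E := fderiv ℝ f p (0, 1)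

/-- `E`, the first coefficient of the first fundamental form. -/
def Ef (x : ℝ × ℝ → V4) (p : ℝ × ℝ) : ℝ := ip (pu x p) (pu x p)

/-- Normal projection of a vector `w` at the point `p` of the surface `x`:
`w^⊥ = w − (⟨w,x_u⟩/E)·x_u + (⟨w,x_v⟩/E)·x_v`. -/
def nproj (x : ℝ × ℝ → V4) (w : V4) (p : ℝ × ℝ) : V4 :=
  w - (ip w (pu x p) / Ef x p) • pu x p + (ip w (pv x p) / Ef x p) • pv x p

/-- `a = (x_uu)^⊥`. -/
def sffA (x : ℝ × ℝ → V4) (p : ℝ × ℝ) : V4 := nproj x (pu (pu x) p) p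

/-- `b = (x_uv)^⊥`. -/
def sffB (x : ℝ × ℝ → V4) (p : ℝ × ℝ) : V4 := nproj x (pv (pu x) p) p

/-- Determinant of the 4×4 matrix with columns `v1, v2, v3, v4`. -/
def det4 (v1 v2 v3 v4 : V4) : ℝ := (Matrix.of ![v1, v2, v3, v4]).transpose.det

/-- The Gauss curvature `K = (⟨b,b⟩ − ⟨a,a⟩)/E²`. -/
def GaussK (x : ℝ × ℝ → V4) (p : ℝ × ℝ) : ℝ :=
  (ip (sffB x p) (sffB x p) - ip (sffA x p) (sffA x p)) / (Ef x p) ^ 2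

/-- The curvature of the normal connection `ϰ = −2·det[x_u,x_v,a,b]/E³`. -/
def NormK (x : ℝ × ℝ → V4) (p : ℝ × ℝ) : ℝ :=
  -2 * det4 (pu x p) (pv x p) (sffA x p) (sffB x p) / (Ef x p) ^ 3

/-- The hyperbolic Laplacian `Δʰ f = f_uu − f_vv`. -/
def hlap (f : ℝ × ℝ → ℝ) (p : ℝ × ℝ) : ℝ := pu (pu f) p - pv (pv f) p

/-- Time-like surface in isothermal coordinates with `E < 0`. -/
def IsTimelikeIso (D : Set (ℝ × ℝ)) (x : ℝ × ℝ → V4) : Prop :=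
  ∀ p ∈ D, Ef x p < 0 ∧ ip (pv x p) (pv x p) = -(Ef x p) ∧ ip (pu x p) (pv x p) = 0

/-- Minimality: `x_uu − x_vv = 0`. -/
def IsMinimal (D : Set (ℝ × ℝ)) (x : ℝ × ℝ → V4) : Prop :=
  ∀ p ∈ D, pu (pu x) p - pv (pv x) p = 0

/-- Degenerate point: `(⟨a,a⟩+⟨b,b⟩)² = 4⟨a,b⟩²`. -/
def DegeneratePt (x : ℝ × ℝ → V4) (p : ℝ × ℝ) : Prop :=
  (ip (sffA x p) (sffA x p) + ip (sffB x p) (sffB x p)) ^ 2 =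
    4 * (ip (sffA x p) (sffB x p)) ^ 2

/-- Surface of the first type. -/
def FirstType (D : Set (ℝ × ℝ)) (x : ℝ × ℝ → V4) : Prop :=
  ∀ p ∈ D,
    (ip (sffA x p) (sffA x p) + ip (sffB x p) (sffB x p)) ^ 2 -
      4 * (ip (sffA x p) (sffB x p)) ^ 2 > 0 ∧
    ip (sffA x p) (sffA x p) + ip (sffB x p) (sffB x p) > 0

/-- Surface of the second type. -/
def SecondType (D : Set (ℝ × ℝ)) (x : ℝ × ℝ → V4) : Prop :=
  ∀ p ∈ D,
    (ip (sffA x p) (sffA x p) + ip (sffB x p) (sffB x p)) ^ 2 -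
      4 * (ip (sffA x p) (sffB x p)) ^ 2 > 0 ∧
    ip (sffA x p) (sffA x p) + ip (sffB x p) (sffB x p) < 0

/-- Surface of the third type. -/
def ThirdType (D : Set (ℝ × ℝ)) (x : ℝ × ℝ → V4) : Prop :=
  ∀ p ∈ D,
    (ip (sffA x p) (sffA x p) + ip (sffB x p) (sffB x p)) ^ 2 -
      4 * (ip (sffA x p) (sffB x p)) ^ 2 < 0

/-- Canonical coordinates with parameters `(e0, e1)`:
`⟨a,a⟩+⟨b,b⟩ = e0` and `2⟨a,b⟩ = e1` identically. -/
def Canonical (D : Set (ℝ × ℝ)) (x : ℝ × ℝ → V4) (e0 e1 : ℝ) : Prop :=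
  ∀ p ∈ D,
    ip (sffA x p) (sffA x p) + ip (sffB x p) (sffB x p) = e0 ∧
    2 * ip (sffA x p) (sffB x p) = e1

/-- The coordinate swap `(u,v) ↦ (v,u)`. -/
def swap2 : ℝ × ℝ → ℝ × ℝ := fun s => (s.2, s.1)

/-- Chain rule for the swap; `f` need not be differentiable, the swap being a linear equivalence. -/
lemma fderiv_comp_swap2 {E : Type*} [NormedAddCommGroup E] [NormedSpace ℝ E]
    (f : ℝ × ℝ → E) (p w : ℝ × ℝ) :
    fderiv ℝ (f ∘ swap2) p w = fderiv ℝ f (swap2 p) (swap2 w) := by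
  have h := (ContinuousLinearEquiv.prodComm ℝ ℝ ℝ).comp_right_fderiv (f := f) (x := p)
  exact congrArg (fun L : ℝ × ℝ →L[ℝ] E => L w) h

lemma pu_comp_swap2 {E : Type*} [NormedAddCommGroup E] [NormedSpace ℝ E]
    (f : ℝ × ℝ → E) : pu (f ∘ swap2) = pv f ∘ swap2 :=
  funext fun p => fderiv_comp_swap2 f p (1, 0)

lemma pv_comp_swap2 {E : Type*} [NormedAddCommGroup E] [NormedSpace ℝ E]
    (f : ℝ × ℝ → E) : pv (f ∘ swap2) = pu f ∘ swap2 :=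
  funext fun p => fderiv_comp_swap2 f p (0, 1)

lemma contDiff_swap2 {n : WithTop ℕ∞} : ContDiff ℝ n swap2 :=
  contDiff_snd.prodMk contDiff_fst

lemma pu_congr {E : Type*} [NormedAddCommGroup E] [NormedSpace ℝ E] {D : Set (ℝ × ℝ)}
    (hD : IsOpen D) {f g : ℝ × ℝ → E} (h : Set.EqOn f g D) {p : ℝ × ℝ} (hp : p ∈ D) :
    pu f p = pu g p := by
  unfold pu
  rw [(h.eventuallyEq_of_mem (hD.mem_nhds hp)).fderiv_eq]

lemma pv_congr {E : Type*} [NormedAddCommGroup E] [NormedSpace ℝ E] {D : Set (ℝ × ℝ)}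
    (hD : IsOpen D) {f g : ℝ × ℝ → E} (h : Set.EqOn f g D) {p : ℝ × ℝ} (hp : p ∈ D) :
    pv f p = pv g p := by
  unfold pv
  rw [(h.eventuallyEq_of_mem (hD.mem_nhds hp)).fderiv_eq]

/-- Symmetry of the mixed second partial derivatives. -/
lemma pu_pv_eq_pv_pu {E : Type*} [NormedAddCommGroup E] [NormedSpace ℝ E]
    {f : ℝ × ℝ → E} {p : ℝ × ℝ} (hf : ContDiffAt ℝ 2 f p) : pu (pv f) p = pv (pu f) p := by
  have hd : DifferentiableAt ℝ (fderiv ℝ f) p :=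
    (hf.fderiv_right (m := 1) (by norm_num)).differentiableAt (by norm_num)
  have hsymm : IsSymmSndFDerivAt ℝ f p := hf.isSymmSndFDerivAt (by simp)
  have key (w z : ℝ × ℝ) :
      fderiv ℝ (fun q => fderiv ℝ f q w) p z = fderiv ℝ (fderiv ℝ f) p z w := by
    rw [fderiv_clm_apply hd (differentiableAt_const w)]
    simp
  exact (key (0, 1) (1, 0)).trans ((hsymm.eq _ _).trans (key (1, 0) (0, 1)).symm)

lemma ip_comm (a b : V4) : ip a b = ip b a := by
  unfold ip
  ring

lemma det4_swap_last (a b c d : V4) : det4 a b d c = -det4 a b c d := by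
  simp only [det4, Matrix.det_transpose]
  have h : Matrix.of ![a, b, d, c] =
      (Matrix.of ![a, b, c, d]).submatrix (Equiv.swap (2 : Fin 4) 3) id := by
    ext i j
    fin_cases i <;> rfl
  rw [h, Matrix.det_permute, Equiv.Perm.sign_swap (by decide)]
  simp

/-- The conjugate surface, reparametrized by the swap `(u,v) ↦ (v,u)`,
i.e. `ŷ(u,v) = y(v,u)`, is a minimal time-like surface in isothermal coordinates with
`Ê(u,v) = E(v,u) < 0`; its normal projections satisfy `â(u,v) = b(v,u)` and
`b̂(u,v) = a(v,u)` (so canonicity with the same parameters is inherited), and its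
curvatures satisfy `K̂(u,v) = −K(v,u)`, `ϰ̂(u,v) = −ϰ(v,u)`. -/
theorem stmt_19 (D : Set (ℝ × ℝ)) (hD : IsOpen D) (x y : ℝ × ℝ → V4)
    (hx : ContDiffOn ℝ (⊤ : ℕ∞) x D) (hy : ContDiffOn ℝ (⊤ : ℕ∞) y D)
    (hiso : IsTimelikeIso D x) (hmin : IsMinimal D x)
    (hconj : ∀ p ∈ D, pu y p = pv x p ∧ pv y p = pu x p) :
    ContDiffOn ℝ (⊤ : ℕ∞) (y ∘ swap2) (swap2 ⁻¹' D) ∧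
    IsTimelikeIso (swap2 ⁻¹' D) (y ∘ swap2) ∧
    IsMinimal (swap2 ⁻¹' D) (y ∘ swap2) ∧
    (∀ p ∈ swap2 ⁻¹' D,
      Ef (y ∘ swap2) p = Ef x (swap2 p) ∧
      Ef (y ∘ swap2) p < 0 ∧
      sffA (y ∘ swap2) p = sffB x (swap2 p) ∧
      sffB (y ∘ swap2) p = sffA x (swap2 p) ∧
      GaussK (y ∘ swap2) p = -(GaussK x (swap2 p)) ∧
      NormK (y ∘ swap2) p = -(NormK x (swap2 p))) ∧
    (∀ e0 e1 : ℝ,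
      ((e0, e1) = (1, 0) ∨ (e0, e1) = (-1, 0) ∨ (e0, e1) = (0, 1)) →
      Canonical D x e0 e1 → Canonical (swap2 ⁻¹' D) (y ∘ swap2) e0 e1) := by
  have hu : pu (y ∘ swap2) = pv y ∘ swap2 := pu_comp_swap2 y
  have hv : pv (y ∘ swap2) = pu y ∘ swap2 := pv_comp_swap2 y
  have hyu : Set.EqOn (pu y) (pv x) D := fun p hp => (hconj p hp).1
  have hyv : Set.EqOn (pv y) (pu x) D := fun p hp => (hconj p hp).2
  have hu1 : ∀ p ∈ swap2 ⁻¹' D, pu (y ∘ swap2) p = pu x (swap2 p) := fun p hp => by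
    rw [hu]; exact hyv hp
  have hv1 : ∀ p ∈ swap2 ⁻¹' D, pv (y ∘ swap2) p = pv x (swap2 p) := fun p hp => by
    rw [hv]; exact hyu hp
  have huu : ∀ p ∈ swap2 ⁻¹' D, pu (pu (y ∘ swap2)) p = pv (pu x) (swap2 p) := fun p hp => by
    rw [hu, pu_comp_swap2]; exact pv_congr hD hyv hp
  have huv : ∀ p ∈ swap2 ⁻¹' D, pv (pu (y ∘ swap2)) p = pu (pu x) (swap2 p) := fun p hp => by
    rw [hu, pv_comp_swap2]; exact pu_congr hD hyv hp
  have hvv : ∀ p ∈ swap2 ⁻¹' D, pv (pv (y ∘ swap2)) p = pu (pv x) (swap2 p) := fun p hp => by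
    rw [hv, pv_comp_swap2]; exact pu_congr hD hyu hp
  have hE : ∀ p ∈ swap2 ⁻¹' D, Ef (y ∘ swap2) p = Ef x (swap2 p) := fun p hp => by
    simp only [Ef, hu1 p hp]
  have hA : ∀ p ∈ swap2 ⁻¹' D, sffA (y ∘ swap2) p = sffB x (swap2 p) := fun p hp => by
    simp only [sffA, sffB, nproj, hE p hp, hu1 p hp, hv1 p hp, huu p hp]
  have hB : ∀ p ∈ swap2 ⁻¹' D, sffB (y ∘ swap2) p = sffA x (swap2 p) := fun p hp => by
    simp only [sffA, sffB, nproj, hE p hp, hu1 p hp, hv1 p hp, huv p hp]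
  refine ⟨hy.comp contDiff_swap2.contDiffOn fun _ hp => hp, fun p hp => ?_, fun p hp => ?_,
    fun p hp => ⟨hE p hp, ?_, hA p hp, hB p hp, ?_, ?_⟩, fun e0 e1 _ hcan p hp => ?_⟩
  · rw [hE p hp, hu1 p hp, hv1 p hp]
    exact hiso _ hp
  · have hx2 : ContDiffAt ℝ 2 x (swap2 p) :=
      (hx.contDiffAt (hD.mem_nhds hp)).of_le (WithTop.coe_le_coe.2 (le_top (a := (2 : ℕ∞))))
    rw [huu p hp, hvv p hp, pu_pv_eq_pv_pu hx2, sub_self]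
  · rw [hE p hp]
    exact (hiso _ hp).1
  · simp only [GaussK, hA p hp, hB p hp, hE p hp]
    ring
  · simp only [NormK, hA p hp, hB p hp, hE p hp, hu1 p hp, hv1 p hp]
    rw [det4_swap_last]
    ring
  · rw [hA p hp, hB p hp, add_comm, ip_comm (sffB x _) (sffA x _)]
    exact hcan _ hp
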